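/- Let G be an unweighted d-regular graph on n vertices with no self-loops and adjacency matrix A, and let v₂ be a unit eigenvector of A/d with eigenvalue λ₂ such that every entry of v₂ has absolute value exactly 1/√n and mean(v₂) = 0. Then the average local agreement of v₂ equals 𝓛(G, v₂) = λ₂/2 + 1/2. -/

import Mathlib

open Matrix Finset

/-- The mean of a vector in `ℝⁿ`. -/
noncomputable def mean {n : ℕ} (x : Fin n → ℝ) : ℝ := (∑ i, x i) / (n : ℝ)

/-- The entrywise sign vector: `+1` where `xᵢ ≥ 0` and `−1` where `xᵢ < 0`. -/
noncomputable def signVec {n : ℕ} (x : Fin n → ℝ) : Fin n → ℝ :=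
  fun i => if 0 ≤ x i then 1 else -1

/-- Average local agreement `𝓛(G, z)`: the average over nodes `i` of the
fraction of `i`'s neighbors whose opinion lies on the same side of the mean
opinion as `i`'s. -/
noncomputable def localAgreement {n : ℕ} (G : SimpleGraph (Fin n))
    [DecidableRel G.Adj] (z : Fin n → ℝ) : ℝ :=
  (1 / (n : ℝ)) * ∑ i, (1 / (G.degree i : ℝ)) *
    ∑ j ∈ G.neighborFinset i,
      if signVec (z - mean z • (1 : Fin n → ℝ)) i =
          signVec (z - mean z • (1 : Fin n → ℝ)) j then (1 : ℝ) else 0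

/-- Sign agreement of two entries of equal nonzero absolute value, as a polynomial in the entries. -/
theorem ite_signVec_eq_of_abs_eq {n : ℕ} {x : Fin n → ℝ} {c : ℝ} (hc : 0 < c) {i j : Fin n}
    (hi : |x i| = c) (hj : |x j| = c) :
    (if signVec x i = signVec x j then (1 : ℝ) else 0) = (c ^ 2)⁻¹ * x i * x j / 2 + 1 / 2 := by
  have hc' := hc.ne'
  unfold signVec
  rcases (abs_eq hc.le).mp hi with h | h <;> rcases (abs_eq hc.le).mp hj with h' | h' <;>
    simp only [h, h', hc.le, Left.nonneg_neg_iff, not_le.mpr hc, if_true, if_false] <;>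
    norm_num <;> field_simp <;> norm_num

/-- For an eigenvector of `A/d` with entries of constant nonzero absolute value, every node agrees
in sign with the same fraction of its neighbors. -/
theorem sum_neighborFinset_signVec_eq {n d : ℕ} (hd : 0 < d) (G : SimpleGraph (Fin n))
    [DecidableRel G.Adj] (hreg : G.IsRegularOfDegree d) {x : Fin n → ℝ} {lam c : ℝ}
    (heig : ((d : ℝ)⁻¹ • G.adjMatrix ℝ) *ᵥ x = lam • x) (hc : 0 < c) (hx : ∀ i, |x i| = c)
    (i : Fin n) :
    (1 / (G.degree i : ℝ)) * ∑ j ∈ G.neighborFinset i,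
      (if signVec x i = signVec x j then (1 : ℝ) else 0) = lam / 2 + 1 / 2 := by
  have hd' : (d : ℝ) ≠ 0 := by positivity
  have hsum : ∑ j ∈ G.neighborFinset i, x j = d * (lam * x i) := by
    have h := congrFun heig i
    rw [smul_mulVec, Pi.smul_apply, SimpleGraph.adjMatrix_mulVec_apply, Pi.smul_apply,
      smul_eq_mul, smul_eq_mul] at h
    rw [← h, mul_inv_cancel_left₀ hd']
  have hsq : x i ^ 2 = c ^ 2 := by rw [← sq_abs, hx i]
  simp_rw [fun j => ite_signVec_eq_of_abs_eq hc (hx i) (hx j)]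
  rw [sum_add_distrib, ← sum_div, ← mul_sum, hsum, sum_const,
    SimpleGraph.card_neighborFinset_eq_degree,
    hreg i, nsmul_eq_mul]
  field_simp
  linear_combination lam * hsq

/-- For an unweighted `d`-regular graph `G` on `n` vertices with
no self-loops and adjacency matrix `A`, if `v₂` is a unit eigenvector of `A/d`
with eigenvalue `λ₂` whose entries all have absolute value exactly `1/√n` and
whose mean is zero, then `𝓛(G, v₂) = λ₂/2 + 1/2`. -/
theorem local_agreement_eigenvector_value {n d : ℕ} (hn : 0 < n) (hd : 0 < d)
    (G : SimpleGraph (Fin n)) [DecidableRel G.Adj]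
    (hreg : G.IsRegularOfDegree d)
    (v2 : Fin n → ℝ) (lam2 : ℝ)
    (heig : ((d : ℝ)⁻¹ • G.adjMatrix ℝ) *ᵥ v2 = lam2 • v2)
    (hunit : ∑ i, v2 i ^ 2 = 1)
    (hentries : ∀ i, |v2 i| = 1 / Real.sqrt n)
    (hmean : mean v2 = 0) :
    localAgreement G v2 = lam2 / 2 + 1 / 2 := by
  have hn' : (n : ℝ) ≠ 0 := by positivity
  have hc : 0 < 1 / Real.sqrt n := by positivity
  have hz : v2 - mean v2 • (1 : Fin n → ℝ) = v2 := by rw [hmean, zero_smul, sub_zero]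
  unfold localAgreement
  rw [hz, sum_congr rfl fun i _ => sum_neighborFinset_signVec_eq hd G hreg heig hc hentries i,
    sum_const, card_univ, Fintype.card_fin, nsmul_eq_mul, one_div, inv_mul_cancel_left₀ hn']
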